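/- Let Ω ⊆ ℝ^N be open and connected and let Φ : Ω → ℝ^N be a C^∞ map such that for every C^∞ function f : ℝ^N → ℝ one has Δ(f ∘ Φ)(y) = (Δf)(Φ(y)) for all y ∈ Ω. Then Φ is affine with orthogonal linear part: there exist an orthogonal matrix A ∈ O(N) and a vector b ∈ ℝ^N such that Φ(y) = Ay + b for all y ∈ Ω. -/

import Mathlib

/-- The Euclidean Laplacian `Δg(y) = Σ_i ∂²g/∂y_i²(y)` of a function on `ℝ^N`,
expressed via iterated Fréchet derivatives in the coordinate directions. -/
noncomputable def laplacianAt {N : ℕ} {E : Type*} [NormedAddCommGroup E] [NormedSpace ℝ E]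
    (g : (Fin N → ℝ) → E) (y : Fin N → ℝ) : E :=
  ∑ i : Fin N, fderiv ℝ (fun z => fderiv ℝ g z (Pi.single i 1)) y (Pi.single i 1)

lemma fderiv_fderiv_apply {E F : Type*} [NormedAddCommGroup E] [NormedSpace ℝ E]
    [NormedAddCommGroup F] [NormedSpace ℝ F] {u : E → F} {y : E}
    (hu : ContDiffAt ℝ 2 u y) (v w : E) :
    fderiv ℝ (fun z => fderiv ℝ u z v) y w = fderiv ℝ (fderiv ℝ u) y w v := by
  have h : DifferentiableAt ℝ (fderiv ℝ u) y :=
    (hu.fderiv_right (m := 1) (by norm_num)).differentiableAt one_ne_zero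
  rw [fderiv_clm_apply h (differentiableAt_const v)]
  simp

lemma differentiableAt_fderiv_apply {E F : Type*} [NormedAddCommGroup E] [NormedSpace ℝ E]
    [NormedAddCommGroup F] [NormedSpace ℝ F] {u : E → F} {y : E}
    (hu : ContDiffAt ℝ 2 u y) (v : E) :
    DifferentiableAt ℝ (fun z => fderiv ℝ u z v) y :=
  ((hu.fderiv_right (m := 1) (by norm_num)).differentiableAt one_ne_zero).clm_apply
    (differentiableAt_const v)

lemma laplacianAt_mul {N : ℕ} {u v : (Fin N → ℝ) → ℝ} {y : Fin N → ℝ}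
    (hu : ContDiffAt ℝ 2 u y) (hv : ContDiffAt ℝ 2 v y) :
    laplacianAt (fun z => u z * v z) y = u y * laplacianAt v y + v y * laplacianAt u y +
      2 * ∑ i, fderiv ℝ u y (Pi.single i 1) * fderiv ℝ v y (Pi.single i 1) := by
  unfold laplacianAt
  rw [Finset.mul_sum, Finset.mul_sum, Finset.mul_sum, ← Finset.sum_add_distrib,
    ← Finset.sum_add_distrib]
  refine Finset.sum_congr rfl fun i _ => ?_
  have hfst : (fun z => fderiv ℝ (fun z => u z * v z) z (Pi.single i 1)) =ᶠ[nhds y]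
      fun z => u z * fderiv ℝ v z (Pi.single i 1) + v z * fderiv ℝ u z (Pi.single i 1) := by
    filter_upwards [hu.eventually (by simp), hv.eventually (by simp)] with z hz hz'
    rw [fderiv_fun_mul (hz.differentiableAt two_ne_zero) (hz'.differentiableAt two_ne_zero)]
    simp
  have hu' := hu.differentiableAt two_ne_zero
  have hv' := hv.differentiableAt two_ne_zero
  have hdu := differentiableAt_fderiv_apply hu (Pi.single i 1)
  have hdv := differentiableAt_fderiv_apply hv (Pi.single i 1)
  rw [hfst.fderiv_eq, fderiv_fun_add (hu'.fun_mul hdv) (hv'.fun_mul hdu), fderiv_fun_mul hu' hdv,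
    fderiv_fun_mul hv' hdu]
  simp
  ring

lemma fderiv_coord {N : ℕ} (k : Fin N) (y v : Fin N → ℝ) :
    fderiv ℝ (fun x : Fin N → ℝ => x k) y v = v k := by
  rw [(hasFDerivAt_apply k y).fderiv]
  rfl

lemma laplacianAt_coord {N : ℕ} (k : Fin N) (y : Fin N → ℝ) :
    laplacianAt (fun x : Fin N → ℝ => x k) y = 0 := by
  simp [laplacianAt, fderiv_coord]

lemma contDiff_coord {N : ℕ} {n : WithTop ℕ∞} (k : Fin N) :
    ContDiff ℝ n (fun x : Fin N → ℝ => x k) :=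
  contDiff_apply ℝ ℝ k

/-- An array symmetric in its first two indices and antisymmetric in its last two
vanishes. -/
lemma eq_zero_of_symm_of_antisymm {ι : Type*} {T : ι → ι → ι → ℝ}
    (hs : ∀ m i j, T m i j = T i m j) (ha : ∀ m i j, T m i j = -T m j i) (m i j : ι) :
    T m i j = 0 := by
  linarith [hs m i j, ha i m j, hs i j m, ha j i m, hs j m i, ha m j i]

section JacobianMatrix

variable {N : ℕ}

/-- The Jacobian matrix of `Φ`, whose rows are the gradients of the components of `Φ`. -/
noncomputable def jacobianMatrix (Φ : (Fin N → ℝ) → (Fin N → ℝ)) (y : Fin N → ℝ) :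
    Matrix (Fin N) (Fin N) ℝ :=
  Matrix.of fun k i => fderiv ℝ (fun z => Φ z k) y (Pi.single i 1)

lemma jacobianMatrix_mem_orthogonalGroup {Φ : (Fin N → ℝ) → (Fin N → ℝ)} {y : Fin N → ℝ}
    (hΦ : ∀ k, ContDiffAt ℝ 2 (fun z => Φ z k) y)
    (hcomm : ∀ f : (Fin N → ℝ) → ℝ, ContDiff ℝ (⊤ : ℕ∞) f →
      laplacianAt (fun z => f (Φ z)) y = laplacianAt f (Φ y)) :
    jacobianMatrix Φ y ∈ Matrix.orthogonalGroup (Fin N) ℝ := by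
  have hharm (k : Fin N) : laplacianAt (fun z => Φ z k) y = 0 :=
    (hcomm (fun x => x k) (contDiff_coord k)).trans (laplacianAt_coord k _)
  rw [Matrix.mem_orthogonalGroup_iff]
  ext k l
  have h := hcomm (fun x => x k * x l) ((contDiff_coord k).mul (contDiff_coord l))
  rw [laplacianAt_mul (hΦ k) (hΦ l), hharm, hharm,
    laplacianAt_mul (contDiff_coord k).contDiffAt (contDiff_coord l).contDiffAt,
    laplacianAt_coord, laplacianAt_coord] at h
  simp only [fderiv_coord, mul_zero, zero_add, Pi.single_apply, mul_ite, mul_one,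
    Finset.sum_ite_eq, Finset.mem_univ, if_true] at h
  simp only [Matrix.mul_apply, Matrix.transpose_apply, jacobianMatrix, Matrix.of_apply,
    Matrix.one_apply]
  split_ifs at h ⊢ <;> linarith

/-- If the Jacobian matrix of a `C²` map is orthogonal near a point, then the second derivative
vanishes at that point. -/
lemma fderiv_fderiv_eq_zero_of_jacobianMatrix_mem_orthogonalGroup
    {Φ : (Fin N → ℝ) → (Fin N → ℝ)} {y : Fin N → ℝ}
    (hΦ : ∀ k, ContDiffAt ℝ 2 (fun z => Φ z k) y)
    (hO : ∀ᶠ z in nhds y, jacobianMatrix Φ z ∈ Matrix.orthogonalGroup (Fin N) ℝ) (k : Fin N) :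
    fderiv ℝ (fderiv ℝ (fun z => Φ z k)) y = 0 := by
  set A := jacobianMatrix Φ y with hA
  let H (m i : Fin N) : Fin N → ℝ := fun k =>
    fderiv ℝ (fderiv ℝ (fun z => Φ z k)) y (Pi.single m 1) (Pi.single i 1)
  let T (m i j : Fin N) : ℝ := ∑ k, H m i k * A k j
  have hsymm (m i j : Fin N) : T m i j = T i m j := by
    refine Finset.sum_congr rfl fun k _ => ?_
    have := (hΦ k).isSymmSndFDerivAt (by simp)
    exact congrArg (· * A k j) (this (Pi.single m 1) (Pi.single i 1))
  have hanti (m i j : Fin N) : T m i j = -T m j i := by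
    have hconst : (fun z => ∑ k, jacobianMatrix Φ z k i * jacobianMatrix Φ z k j) =ᶠ[nhds y]
        fun _ => (1 : Matrix (Fin N) (Fin N) ℝ) i j := by
      filter_upwards [hO] with z hz
      rw [Matrix.mem_orthogonalGroup_iff'] at hz
      simpa [Matrix.mul_apply] using congrFun (congrFun hz i) j
    have hd (k i : Fin N) : DifferentiableAt ℝ (fun z => jacobianMatrix Φ z k i) y :=
      differentiableAt_fderiv_apply (hΦ k) _
    have hH (k i : Fin N) :
        fderiv ℝ (fun z => jacobianMatrix Φ z k i) y (Pi.single m 1) = H m i k :=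
      fderiv_fderiv_apply (hΦ k) _ _
    have hfd := hconst.fderiv_eq (𝕜 := ℝ)
    rw [fderiv_fun_sum fun k _ => (hd k i).fun_mul (hd k j)] at hfd
    have h := congrArg (fun L : (Fin N → ℝ) →L[ℝ] ℝ => L (Pi.single m 1)) hfd
    simp only [fderiv_fun_mul (hd _ _) (hd _ _), sum_apply,
      add_apply, smul_apply, hH, smul_eq_mul,
      fderiv_const_apply, zero_apply, Finset.sum_add_distrib] at h
    simp only [T, hA, mul_comm (H _ _ _)]
    linarith
  have hH (m i : Fin N) : H m i = 0 := by
    have hmul : Matrix.vecMul (H m i) A = 0 :=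
      funext fun j => eq_zero_of_symm_of_antisymm hsymm hanti m i j
    calc H m i = Matrix.vecMul (Matrix.vecMul (H m i) A) A.transpose := by
          rw [Matrix.vecMul_vecMul, (Matrix.mem_orthogonalGroup_iff _ _).1 hO.self_of_nhds,
            Matrix.vecMul_one]
      _ = 0 := by rw [hmul, Matrix.zero_vecMul]
  refine ContinuousLinearMap.coe_injective ((Pi.basisFun ℝ (Fin N)).ext fun m =>
    ContinuousLinearMap.coe_injective ((Pi.basisFun ℝ (Fin N)).ext fun i => ?_))
  simpa using congrFun (hH m i) k

end JacobianMatrix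

/-- If `Φ : Ω → ℝ^N` is `C^∞` on the open connected set `Ω` and
`Δ(f ∘ Φ) = (Δf) ∘ Φ` on `Ω` for every `C^∞` function `f : ℝ^N → ℝ`, then `Φ` is affine
with orthogonal linear part: `Φ(y) = Ay + b` with `A ∈ O(N)` and `b ∈ ℝ^N`. -/
theorem laplacian_commuting_map_is_affine_orthogonal
    {N : ℕ} (Ω : Set (Fin N → ℝ)) (hΩo : IsOpen Ω) (hΩc : IsConnected Ω)
    (Φ : (Fin N → ℝ) → (Fin N → ℝ)) (hΦ : ContDiffOn ℝ (⊤ : ℕ∞) Φ Ω)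
    (hcomm : ∀ f : (Fin N → ℝ) → ℝ, ContDiff ℝ (⊤ : ℕ∞) f →
      ∀ y ∈ Ω, laplacianAt (fun z => f (Φ z)) y = laplacianAt f (Φ y)) :
    ∃ A ∈ Matrix.orthogonalGroup (Fin N) ℝ, ∃ b : Fin N → ℝ,
      ∀ y ∈ Ω, Φ y = A.mulVec y + b := by
  have hsm (y) (hy : y ∈ Ω) (k : Fin N) : ContDiffAt ℝ 2 (fun z => Φ z k) y :=
    contDiffAt_pi.1 ((hΦ.contDiffAt (hΩo.mem_nhds hy)).of_le (WithTop.coe_le_coe.2 le_top)) k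
  have hO (y) (hy : y ∈ Ω) : jacobianMatrix Φ y ∈ Matrix.orthogonalGroup (Fin N) ℝ :=
    jacobianMatrix_mem_orthogonalGroup (hsm y hy) fun f hf => hcomm f hf y hy
  obtain ⟨y₀, hy₀⟩ := hΩc.nonempty
  have hconst (k : Fin N) :
      Ω.EqOn (fderiv ℝ fun z => Φ z k) (fun _ => fderiv ℝ (fun z => Φ z k) y₀) := by
    intro y hy
    refine hΩo.is_const_of_fderiv_eq_zero (𝕜 := ℝ) hΩc.isPreconnected (fun z hz => ?_)
      (fun z hz => ?_) hy hy₀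
    · exact (((hsm z hz k).fderiv_right (m := 1) (by norm_num)).differentiableAt
        one_ne_zero).differentiableWithinAt
    · exact fderiv_fderiv_eq_zero_of_jacobianMatrix_mem_orthogonalGroup (hsm z hz)
        (Filter.eventually_of_mem (hΩo.mem_nhds hz) hO) k
  have haff (k : Fin N) : ∃ b : ℝ, Ω.EqOn (fun z => Φ z k)
      (fun z => fderiv ℝ (fun z => Φ z k) y₀ z + b) := by
    refine hΩo.exists_eq_add_of_fderiv_eq (𝕜 := ℝ) hΩc.isPreconnected
      (fun z hz => ((hsm z hz k).differentiableAt two_ne_zero).differentiableWithinAt)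
      (ContinuousLinearMap.differentiable _).differentiableOn fun z hz => ?_
    rw [hconst k hz, ContinuousLinearMap.fderiv]
  choose b hb using haff
  refine ⟨jacobianMatrix Φ y₀, hO y₀ hy₀, b, fun y hy => funext fun k => ?_⟩
  refine (hb k hy).trans ?_
  rw [Pi.add_apply]
  conv_lhs => rw [pi_eq_sum_univ' y]
  simp [jacobianMatrix, Matrix.mulVec, dotProduct, mul_comm]
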